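/- Let 𝒯 be a finite index set of trajectories, S a finite nonempty type of sites, c : 𝒯 → S → ℝ a cost function, and F a fixed finite nonempty set of existing facilities. Define TI(Q) = Σ_{j ∈ 𝒯} min_{s ∈ Q ∪ F} c(j,s). Let k ≥ 1 and let Q_0 = ∅, Q_{i+1} = Q_i ∪ {s_i} for 0 ≤ i < k, where at each step s_i ∈ S minimizes TI(Q_i ∪ {s}) over all s ∈ S (the GREAT greedy choice). Then for every set OPT of sites with |OPT| = k, TI(Q_k) ≤ (1 − 1/e) · TI(OPT) + TI(∅)/e, where TI(∅) is the total inconvenience offered by the existing facilities F alone. (Theorem 7.) -/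

import Mathlib

/-- Total inconvenience of all trajectories `𝒯` when the new sites `Q` are
added to the existing facilities `F`: each trajectory `j` is served by its
nearest facility in `Q ∪ F`, at cost `c j s`. -/
noncomputable def totalInc {J S : Type*} [DecidableEq S] (𝒯 : Finset J)
    (c : J → S → ℝ) (F : Finset S) (hF : F.Nonempty) (Q : Finset S) : ℝ :=
  ∑ j ∈ 𝒯, (Q ∪ F).inf' (hF.mono Finset.subset_union_right) (c j)

theorem totalInc_anti {J S : Type*} [DecidableEq S] (𝒯 : Finset J) (c : J → S → ℝ)
    (F : Finset S) (hF : F.Nonempty) : Antitone (totalInc 𝒯 c F hF) := by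
  intro A B hAB
  exact Finset.sum_le_sum fun j _ =>
    Finset.inf'_mono (c j) (Finset.union_subset_union_left hAB) (hF.mono Finset.subset_union_right)

/-- The gain of adding all of `P` to `Q` is at most the sum of the gains of adding each single
site of `P`. -/
theorem totalInc_sub_le_sum {J S : Type*} [DecidableEq S] (𝒯 : Finset J) (c : J → S → ℝ)
    (F : Finset S) (hF : F.Nonempty) (Q P : Finset S) :
    totalInc 𝒯 c F hF Q - totalInc 𝒯 c F hF P ≤
      ∑ s ∈ P, (totalInc 𝒯 c F hF Q - totalInc 𝒯 c F hF (Q ∪ {s})) := by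
  simp only [totalInc, ← Finset.sum_sub_distrib]
  rw [Finset.sum_comm]
  refine Finset.sum_le_sum fun j _ => ?_
  have gain_nonneg : ∀ s ∈ P, 0 ≤ (Q ∪ F).inf' (hF.mono Finset.subset_union_right) (c j) -
      (Q ∪ {s} ∪ F).inf' (hF.mono Finset.subset_union_right) (c j) := fun s _ =>
    sub_nonneg.2 (Finset.inf'_mono (c j)
      (Finset.union_subset_union_left Finset.subset_union_left) _)
  obtain ⟨t, ht, hmin⟩ :=
    Finset.exists_mem_eq_inf' (hF.mono (Finset.subset_union_right (s₁ := P))) (c j)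
  rw [hmin]
  rcases Finset.mem_union.1 ht with htP | htF
  · refine le_trans ?_ (Finset.single_le_sum gain_nonneg htP)
    exact sub_le_sub_left (Finset.inf'_le (c j) (by simp)) _
  · exact (sub_nonpos.2 (Finset.inf'_le (c j) (Finset.mem_union_right Q htF))).trans
      (Finset.sum_nonneg gain_nonneg)

theorem great_approximation_bound {J S : Type*} [Fintype S] [Nonempty S] [DecidableEq S]
    (𝒯 : Finset J) (c : J → S → ℝ) (F : Finset S) (hF : F.Nonempty)
    (k : ℕ) (hk : 1 ≤ k) (Q : ℕ → Finset S)
    (hQ0 : Q 0 = ∅)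
    (hgreedy : ∀ i < k, ∃ s : S, Q (i + 1) = Q i ∪ {s} ∧
      ∀ s' : S, totalInc 𝒯 c F hF (Q i ∪ {s}) ≤ totalInc 𝒯 c F hF (Q i ∪ {s'}))
    (OPT : Finset S) (hOPT : OPT.card = k) :
    totalInc 𝒯 c F hF (Q k) ≤
      (1 - 1 / Real.exp 1) * totalInc 𝒯 c F hF OPT +
        totalInc 𝒯 c F hF ∅ / Real.exp 1 := by
  have hk0 : (0 : ℝ) < k := by exact_mod_cast hk
  have hk1 : (1 : ℝ) ≤ k := by exact_mod_cast hk
  have hratio : (0 : ℝ) ≤ 1 - 1 / k := sub_nonneg.2 ((div_le_one hk0).2 hk1)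
  have step : ∀ i < k, totalInc 𝒯 c F hF (Q (i + 1)) - totalInc 𝒯 c F hF OPT ≤
      (1 - 1 / k) * (totalInc 𝒯 c F hF (Q i) - totalInc 𝒯 c F hF OPT) := by
    intro i hi
    obtain ⟨s, hs, hbest⟩ := hgreedy i hi
    have hgain : totalInc 𝒯 c F hF (Q i) - totalInc 𝒯 c F hF OPT ≤
        k * (totalInc 𝒯 c F hF (Q i) - totalInc 𝒯 c F hF (Q (i + 1))) := by
      refine (totalInc_sub_le_sum 𝒯 c F hF (Q i) OPT).trans ?_
      rw [← hOPT, ← nsmul_eq_mul, hs]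
      exact Finset.sum_le_card_nsmul _ _ _ fun s' _ => sub_le_sub_left (hbest s') _
    have hdiv := (div_le_iff₀' hk0).2 hgain
    have hexpand : (1 - 1 / (k : ℝ)) * (totalInc 𝒯 c F hF (Q i) - totalInc 𝒯 c F hF OPT) =
        (totalInc 𝒯 c F hF (Q i) - totalInc 𝒯 c F hF OPT) -
          (totalInc 𝒯 c F hF (Q i) - totalInc 𝒯 c F hF OPT) / k := by ring
    linarith
  have geometric : ∀ i ≤ k, totalInc 𝒯 c F hF (Q i) - totalInc 𝒯 c F hF OPT ≤
      (1 - 1 / k) ^ i * (totalInc 𝒯 c F hF ∅ - totalInc 𝒯 c F hF OPT) := by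
    intro i
    induction i with
    | zero => simp [hQ0]
    | succ i ih =>
      intro hi
      refine (step i hi).trans ?_
      rw [pow_succ', mul_assoc]
      exact mul_le_mul_of_nonneg_left (ih (Nat.le_of_succ_le hi)) hratio
  have hdecay : (1 - 1 / (k : ℝ)) ^ k ≤ 1 / Real.exp 1 := by
    rw [one_div (Real.exp 1), ← Real.exp_neg]
    exact Real.one_sub_div_pow_le_exp_neg hk1
  have hinit : 0 ≤ totalInc 𝒯 c F hF ∅ - totalInc 𝒯 c F hF OPT :=
    sub_nonneg.2 (totalInc_anti 𝒯 c F hF (Finset.empty_subset OPT))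
  have hfinal := (geometric k le_rfl).trans (mul_le_mul_of_nonneg_right hdecay hinit)
  calc totalInc 𝒯 c F hF (Q k)
      ≤ totalInc 𝒯 c F hF OPT +
          1 / Real.exp 1 * (totalInc 𝒯 c F hF ∅ - totalInc 𝒯 c F hF OPT) := by linarith
    _ = _ := by ring
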